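/- There is a universal constant C such that the following holds. Let (X,d) be a metric space and r ∈ X. Then there exist a probability space (Ω,μ) and a family (A_ω)_{ω∈Ω} of online routing algorithms — each A_ω assigns to every finite sequence (v_1,…,v_t) of points of X a path P_t^ω from v_t to r, with outputs on a prefix coinciding with those on the full sequence — such that for every input sequence v_1,…,v_k of k ≥ 1 terminals and every nondecreasing concave function f : [0,∞) → [0,∞) with f(0) = 0, the map ω ↦ cost_f(P^ω) is integrable and E_{ω∼μ}[cost_f(P^ω)] ≤ C·(1 + log₂ k)²·OPT_f. -/

import Mathlib

open MeasureTheory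
open scoped Classical ENNReal

noncomputable section

variable {X : Type*} [MetricSpace X]

/-- The length of an unordered pair of points: the distance between its endpoints. -/
def edgeLen (e : Sym2 X) : ℝ :=
  Sym2.lift ⟨fun x y => dist x y, fun x y => dist_comm x y⟩ e

/-- The edges of a path: the unordered pairs of consecutive points. -/
def edgeList (p : List X) : List (Sym2 X) :=
  (p.zip p.tail).map fun ab => s(ab.1, ab.2)

/-- `p` is a path from `v` to `r`: a finite sequence of points starting at `v`
and ending at `r`. -/
def IsPath (v r : X) (p : List X) : Prop :=
  p.head? = some v ∧ p.getLast? = some r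

/-- All edges occurring in some path of a routing. -/
def allEdges {k : ℕ} (P : Fin k → List X) : Finset (Sym2 X) :=
  Finset.univ.biUnion fun s => (edgeList (P s)).toFinset

/-- The load of an edge `e` under a routing `P`: the number of indices `s`
such that `e` is an edge of `P s`. -/
def load {k : ℕ} (P : Fin k → List X) (e : Sym2 X) : ℕ :=
  (Finset.univ.filter fun s => e ∈ edgeList (P s)).card

/-- The cost of a routing `P` under the cost function `f`:
`∑_{e : load_e(P) > 0} d(e) · f(load_e(P))`. -/
def costf {k : ℕ} (f : ℝ → ℝ) (P : Fin k → List X) : ℝ :=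
  ∑ e ∈ allEdges P, edgeLen e * f (load P e)

/-- The optimal cost, under `f`, of routing the terminals `v` to the root `r`. -/
def OPTf {k : ℕ} (f : ℝ → ℝ) (v : Fin k → X) (r : X) : ℝ :=
  sInf { c | ∃ P : Fin k → List X, (∀ s, IsPath (v s) r (P s)) ∧ c = costf f P }

/-- A probability space: a type with a σ-algebra and a probability measure. -/
structure ProbSpace where
  Ω : Type
  measurableSpace : MeasurableSpace Ω
  μ : @MeasureTheory.Measure Ω measurableSpace
  isProbabilityMeasure : @MeasureTheory.IsProbabilityMeasure Ω measurableSpace μ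

attribute [instance] ProbSpace.measurableSpace

set_option linter.unusedSectionVars false

/-! ### Paths and their edges -/

lemma edgeLen_mk (x y : X) : edgeLen s(x, y) = dist x y := rfl

lemma edgeLen_nonneg (e : Sym2 X) : 0 ≤ edgeLen e := by
  induction e with | _ x y => exact dist_nonneg

lemma edgeList_cons_cons (a b : X) (p : List X) :
    edgeList (a :: b :: p) = s(a, b) :: edgeList (b :: p) := rfl

lemma mem_of_mem_edgeList {p : List X} {a b : X} (h : s(a, b) ∈ edgeList p) :
    a ∈ p ∧ b ∈ p := by
  simp only [edgeList, List.mem_map, Prod.exists] at h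
  obtain ⟨c, d, hcd, h⟩ := h
  have hc := (List.of_mem_zip hcd).1
  have hd := List.mem_of_mem_tail (List.of_mem_zip hcd).2
  rcases Sym2.eq_iff.1 h with ⟨rfl, rfl⟩ | ⟨rfl, rfl⟩
  exacts [⟨hc, hd⟩, ⟨hd, hc⟩]

lemma exists_crossing_edge {v r : X} {p : List X} (hp : IsPath v r p) (S : X → Prop)
    (hv : S v) (hr : ¬ S r) : ∃ a b, s(a, b) ∈ edgeList p ∧ S a ∧ ¬ S b := by
  induction p generalizing v with
  | nil => simp [IsPath] at hp
  | cons a p ih =>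
    obtain rfl : a = v := by simpa [IsPath] using hp.1
    cases p with
    | nil =>
      obtain rfl : a = r := by simpa [IsPath] using hp.2
      exact absurd hv hr
    | cons b p =>
      by_cases hb : S b
      · obtain ⟨x, y, h, hx, hy⟩ := ih (v := b) ⟨rfl, by simpa [IsPath] using hp.2⟩ hb
        exact ⟨x, y, List.mem_cons_of_mem _ h, hx, hy⟩
      · exact ⟨a, b, List.mem_cons_self, hv, hb⟩

/-- The total length of the distinct edges of a path. -/
def pathLen (p : List X) : ℝ := ∑ e ∈ (edgeList p).toFinset, edgeLen e

lemma pathLen_nonneg (p : List X) : 0 ≤ pathLen p :=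
  Finset.sum_nonneg fun e _ => edgeLen_nonneg e

lemma dist_le_pathLen {r : X} {p : List X} (hp : p.getLast? = some r) {z : X} (hz : z ∈ p) :
    dist z r ≤ pathLen p := by
  induction p generalizing z with
  | nil => simp at hz
  | cons a p ih =>
    cases p with
    | nil =>
      obtain rfl : a = r := by simpa using hp
      obtain rfl : z = a := by simpa using hz
      simpa using pathLen_nonneg [z]
    | cons b p =>
      have hp' : (b :: p).getLast? = some r := by simpa using hp
      have hsub : (edgeList (b :: p)).toFinset ⊆ (edgeList (a :: b :: p)).toFinset := by
        intro e he
        simp only [List.mem_toFinset] at he ⊢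
        exact List.mem_cons_of_mem _ he
      by_cases hz' : z ∈ b :: p
      · exact (ih hp' hz').trans
          (Finset.sum_le_sum_of_subset_of_nonneg hsub fun e _ _ => edgeLen_nonneg e)
      · obtain rfl : z = a := by
          rcases List.mem_cons.1 hz with h | h
          exacts [h, absurd h hz']
        have hnot : s(z, b) ∉ (edgeList (b :: p)).toFinset := fun h =>
          hz' (mem_of_mem_edgeList (List.mem_toFinset.1 h)).1
        have hlen : pathLen (z :: b :: p) = dist z b + pathLen (b :: p) := by
          rw [pathLen, edgeList_cons_cons, List.toFinset_cons, Finset.sum_insert hnot, edgeLen_mk,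
            pathLen]
        rw [hlen]
        linarith [dist_triangle z b r, ih hp' List.mem_cons_self]

lemma mem_edgeList_cons_map_range (x : X) (g : ℕ → X) (n : ℕ) {e : Sym2 X}
    (he : e ∈ edgeList (x :: (List.range (n + 1)).map g)) :
    e = s(x, g 0) ∨ ∃ j < n, e = s(g j, g (j + 1)) := by
  induction n generalizing x g with
  | zero =>
    left
    simpa [edgeList] using he
  | succ n ih =>
    rw [List.range_succ_eq_map, List.map_cons, edgeList_cons_cons, List.mem_cons] at he
    rcases he with he | he
    · exact .inl he
    · rw [List.map_map] at he
      rcases ih (g 0) (g ∘ Nat.succ) he with rfl | ⟨j, hj, rfl⟩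
      · exact .inr ⟨0, by omega, rfl⟩
      · exact .inr ⟨j + 1, by omega, rfl⟩

/-! ### Costs -/

/-- The properties of a cost function that the analysis uses, at the integers. -/
structure IsCostFun (f : ℝ → ℝ) : Prop where
  zero : f 0 = 0
  mono : ∀ {m n : ℕ}, m ≤ n → f m ≤ f n
  add_le : ∀ m n : ℕ, f (m + n : ℕ) ≤ f m + f n

lemma isCostFun_of_concaveOn {f : ℝ → ℝ} (hm : MonotoneOn f (Set.Ici 0))
    (hc : ConcaveOn ℝ (Set.Ici 0) f) (h0 : f 0 = 0) : IsCostFun f where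
  zero := h0
  mono h := hm (Set.mem_Ici.2 (Nat.cast_nonneg _)) (Set.mem_Ici.2 (Nat.cast_nonneg _))
    (Nat.cast_le.2 h)
  add_le m n := by
    rcases Nat.eq_zero_or_pos (m + n) with h | h
    · obtain ⟨rfl, rfl⟩ : m = 0 ∧ n = 0 := by omega
      simp [h0]
    have hpos : (0 : ℝ) < m + n := by exact_mod_cast h
    have key : ∀ a b : ℕ, (0 : ℝ) < a + b → (a : ℝ) / (a + b) * f (a + b) ≤ f a := by
      intro a b hab
      have hsum : (a : ℝ) / (a + b) + (b : ℝ) / (a + b) = 1 := by field_simp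
      have := hc.2 (Set.mem_Ici.2 hab.le) (Set.mem_Ici.2 le_rfl)
        (by positivity : (0 : ℝ) ≤ (a : ℝ) / (a + b)) (by positivity) hsum
      simp only [smul_eq_mul, h0, mul_zero, add_zero] at this
      rwa [div_mul_cancel₀ _ hab.ne'] at this
    have h1 := key m n hpos
    have h2 := key n m (by linarith)
    rw [add_comm (n : ℝ) m] at h2
    have : (m : ℝ) / (m + n) * f (m + n) + (n : ℝ) / (m + n) * f (m + n) = f (m + n) := by
      field_simp
    push_cast
    linarith

namespace IsCostFun

variable {f : ℝ → ℝ}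

lemma nonneg (hf : IsCostFun f) (n : ℕ) : 0 ≤ f n := by
  simpa [hf.zero] using hf.mono (Nat.zero_le n)

lemma le_sum {ι : Type*} (hf : IsCostFun f) (s : Finset ι) (n : ι → ℕ) :
    f (∑ i ∈ s, n i : ℕ) ≤ ∑ i ∈ s, f (n i) := by
  induction s using Finset.induction_on with
  | empty => simp [hf.zero]
  | insert a s ha ih =>
    rw [Finset.sum_insert ha, Finset.sum_insert ha]
    exact (hf.add_le _ _).trans (by gcongr)

lemma card_le_sum {ι κ : Type*} (hf : IsCostFun f) (A : Finset κ) (s : Finset ι)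
    (B : ι → Finset κ) (h : ∀ a ∈ A, ∃ i ∈ s, a ∈ B i) :
    f A.card ≤ ∑ i ∈ s, f (B i).card := by
  refine (hf.mono ?_).trans (hf.le_sum s fun i => (B i).card)
  refine (Finset.card_le_card ?_).trans Finset.card_biUnion_le
  intro a ha
  simpa using h a ha

end IsCostFun

section Cost

variable {k : ℕ} {f : ℝ → ℝ}

lemma mem_allEdges {P : Fin k → List X} {e : Sym2 X} :
    e ∈ allEdges P ↔ ∃ s, e ∈ edgeList (P s) := by
  simp [allEdges]

lemma costf_nonneg (hf : IsCostFun f) (P : Fin k → List X) : 0 ≤ costf f P :=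
  Finset.sum_nonneg fun _ _ => mul_nonneg (edgeLen_nonneg _) (hf.nonneg _)

/-- If the edges used by a routing are covered by groups of terminals, where all terminals of a
group use a common edge, then the cost is at most the sum of the costs of the groups. -/
lemma costf_le_sum {γ : Type*} (hf : IsCostFun f) (P : Fin k → List X) (G : Finset γ)
    (E : γ → Sym2 X) (T : γ → Finset (Fin k))
    (h : ∀ s, ∀ e ∈ edgeList (P s), ∃ g ∈ G, E g = e ∧ s ∈ T g) :
    costf f P ≤ ∑ g ∈ G, edgeLen (E g) * f (T g).card := by
  calc costf f P
      ≤ ∑ e ∈ allEdges P, ∑ g ∈ G, if E g = e then edgeLen (E g) * f (T g).card else 0 := by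
        refine Finset.sum_le_sum fun e _ => ?_
        rw [← Finset.sum_filter]
        calc edgeLen e * f (load P e)
            ≤ edgeLen e * ∑ g ∈ G.filter (fun g => E g = e), f (T g).card := by
              refine mul_le_mul_of_nonneg_left (hf.card_le_sum _ _ _ ?_) (edgeLen_nonneg e)
              intro s hs
              obtain ⟨g, hg, hE, hT⟩ := h s e (Finset.mem_filter.1 hs).2
              exact ⟨g, Finset.mem_filter.2 ⟨hg, hE⟩, hT⟩
          _ = _ := by
              rw [Finset.mul_sum]
              refine Finset.sum_congr rfl fun g hg => ?_
              rw [(Finset.mem_filter.1 hg).2]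
    _ = ∑ g ∈ G, ∑ e ∈ allEdges P, if E g = e then edgeLen (E g) * f (T g).card else 0 :=
        Finset.sum_comm
    _ ≤ _ := by
        refine Finset.sum_le_sum fun g _ => ?_
        rw [Finset.sum_ite_eq]
        split_ifs
        · exact le_rfl
        · exact mul_nonneg (edgeLen_nonneg _) (hf.nonneg _)

lemma one_le_load {P : Fin k → List X} {s : Fin k} {e : Sym2 X} (he : e ∈ edgeList (P s)) :
    1 ≤ load P e :=
  Finset.card_pos.2 ⟨s, Finset.mem_filter.2 ⟨Finset.mem_univ s, he⟩⟩

lemma pathLen_mul_le_costf (hf : IsCostFun f) (Q : Fin k → List X) (s : Fin k) :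
    pathLen (Q s) * f 1 ≤ costf f Q := by
  rw [pathLen, Finset.sum_mul]
  calc ∑ e ∈ (edgeList (Q s)).toFinset, edgeLen e * f 1
      ≤ ∑ e ∈ (edgeList (Q s)).toFinset, edgeLen e * f (load Q e) := by
        refine Finset.sum_le_sum fun e he => mul_le_mul_of_nonneg_left ?_ (edgeLen_nonneg e)
        simpa using hf.mono (one_le_load (List.mem_toFinset.1 he))
    _ ≤ costf f Q := by
        refine Finset.sum_le_sum_of_subset_of_nonneg (fun e he => ?_)
          fun e _ _ => mul_nonneg (edgeLen_nonneg e) (hf.nonneg _)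
        exact mem_allEdges.2 ⟨s, List.mem_toFinset.1 he⟩

end Cost

/-! ### Sums over dyadic scales -/

lemma sum_two_zpow_le (J : Finset ℤ) (M : ℤ) (h : ∀ i ∈ J, i < M) :
    ∑ i ∈ J, (2 : ℝ) ^ i ≤ 2 ^ M := by
  induction J using Finset.induction_on_max generalizing M with
  | empty => simpa using (zpow_pos (two_pos : (0 : ℝ) < 2) M).le
  | insert a s ha ih =>
    rw [Finset.sum_insert fun h' => lt_irrefl a (ha a h')]
    have h1 := ih a ha
    have h2 : (2 : ℝ) ^ (a + 1) ≤ 2 ^ M :=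
      zpow_le_zpow_right₀ one_le_two (h a (Finset.mem_insert_self a s))
    rw [zpow_add_one₀ two_ne_zero] at h2
    linarith

lemma sum_two_zpow_filter_le (I : Finset ℤ) {B : ℝ} (hB : 0 ≤ B) :
    ∑ i ∈ I.filter (fun i => (2 : ℝ) ^ i < B), (2 : ℝ) ^ i ≤ 2 * B := by
  rcases hB.eq_or_lt with rfl | hB
  · rw [Finset.filter_false_of_mem fun i _ => (zpow_pos (two_pos : (0 : ℝ) < 2) i).le.not_gt]
    simp
  refine (sum_two_zpow_le _ (Int.clog 2 B) fun i hi => ?_).trans ?_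
  · exact (Int.zpow_lt_iff_lt_clog one_lt_two hB).1 (by simpa using (Finset.mem_filter.1 hi).2)
  · have := Int.zpow_pred_clog_lt_self (b := 2) one_lt_two hB
    rw [Nat.cast_ofNat, zpow_sub_one₀ two_ne_zero] at this
    linarith

lemma card_dyadic_window_le (I : Finset ℤ) (D : ℝ) {k : ℝ} (hk : 1 ≤ k) :
    ((I.filter fun i => (2 : ℝ) ^ i < D ∧ D ≤ 2 ^ i * k).card : ℝ) ≤ 1 + Real.logb 2 k := by
  have hlk : 0 ≤ Real.logb 2 k := Real.logb_nonneg one_lt_two hk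
  rcases le_or_gt D 0 with hD | hD
  · rw [Finset.filter_false_of_mem fun i _ h =>
      (zpow_pos (two_pos : (0 : ℝ) < 2) i).not_ge (h.1.le.trans hD)]
    simp only [Finset.card_empty, Nat.cast_zero]
    linarith
  set A := Real.logb 2 D
  have hsub : (I.filter fun i => (2 : ℝ) ^ i < D ∧ D ≤ 2 ^ i * k) ⊆
      Finset.Ico ⌈A - Real.logb 2 k⌉ ⌈A⌉ := by
    intro i hi
    obtain ⟨-, h1, h2⟩ := Finset.mem_filter.1 hi
    have hp : (0 : ℝ) < 2 ^ i := zpow_pos two_pos i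
    have hi' : Real.logb 2 ((2 : ℝ) ^ i) = i := by
      rw [← Real.rpow_intCast, Real.logb_rpow two_pos (by norm_num)]
    have h1' := Real.logb_lt_logb one_lt_two hp h1
    have h2' := Real.logb_le_logb_of_le one_lt_two hD h2
    rw [Real.logb_mul hp.ne' (by positivity), hi'] at h2'
    rw [hi'] at h1'
    rw [Finset.mem_Ico, Int.ceil_le, Int.lt_ceil]
    exact ⟨by linarith, h1'⟩
  refine (Nat.cast_le.2 (Finset.card_le_card hsub)).trans ?_
  have h3 : ⌈A - Real.logb 2 k⌉ ≤ ⌈A⌉ := Int.ceil_le_ceil (by linarith)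
  have h4 : ((Finset.Ico ⌈A - Real.logb 2 k⌉ ⌈A⌉).card : ℝ) = ⌈A⌉ - ⌈A - Real.logb 2 k⌉ := by
    rw [Int.card_Ico]
    have : (((⌈A⌉ - ⌈A - Real.logb 2 k⌉).toNat : ℤ) : ℝ) = (⌈A⌉ - ⌈A - Real.logb 2 k⌉ : ℤ) := by
      rw [Int.toNat_of_nonneg (by linarith)]
    exact_mod_cast this
  rw [h4]
  linarith [Int.ceil_lt_add_one A, Int.le_ceil (A - Real.logb 2 k)]

/-! ### Labellings at all scales and the cost of routing along them -/

/-- The larger distance to `r` of the two endpoints of an edge. -/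
def edgeRadius (r : X) (e : Sym2 X) : ℝ :=
  Sym2.lift ⟨fun x y => max (dist x r) (dist y r), fun _ _ => max_comm _ _⟩ e

/-- The cell of a point in the common refinement of the partitions at scales `i` and `i + 1`. -/
def cell (L : ℤ → X → ℕ) (i : ℤ) (x : X) : ℕ × ℕ := (L i x, L (i + 1) x)

/-- The endpoints of the edge `e` lie in different cells at scale `i`. -/
def IsCut (L : ℤ → X → ℕ) (i : ℤ) (e : Sym2 X) : Prop :=
  ∃ a b, e = s(a, b) ∧ cell L i a ≠ cell L i b

/-- Exactly one endpoint of the edge `e` lies in the cell `g` at scale `i`. -/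
def Crosses (L : ℤ → X → ℕ) (i : ℤ) (g : ℕ × ℕ) (e : Sym2 X) : Prop :=
  ∃ a b, e = s(a, b) ∧ cell L i a = g ∧ cell L i b ≠ g

lemma sum_crosses_le (L : ℤ → X → ℕ) (i : ℤ) (e : Sym2 X) (G : Finset (ℕ × ℕ)) {y : ℝ}
    (hy : 0 ≤ y) :
    ∑ g ∈ G, (if Crosses L i g e then y else 0) ≤ if IsCut L i e then 2 * y else 0 := by
  induction e with | _ a b
  have hmem : ∀ g, Crosses L i g s(a, b) →
      g ∈ ({cell L i a, cell L i b} : Finset (ℕ × ℕ)) ∧ cell L i a ≠ cell L i b := by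
    rintro g ⟨a', b', he, ha, hb⟩
    rcases Sym2.eq_iff.1 he with ⟨rfl, rfl⟩ | ⟨rfl, rfl⟩
    · exact ⟨by simp [ha], fun h => hb (h ▸ ha)⟩
    · exact ⟨by simp [ha], fun h => hb (h.trans ha)⟩
  by_cases hcut : IsCut L i s(a, b)
  · rw [if_pos hcut, ← Finset.sum_filter, Finset.sum_const, nsmul_eq_mul]
    refine mul_le_mul_of_nonneg_right ?_ hy
    have : (G.filter fun g => Crosses L i g s(a, b)).card ≤ 2 :=
      (Finset.card_le_card fun g hg => (hmem g (Finset.mem_filter.1 hg).2).1).trans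
        Finset.card_le_two
    exact_mod_cast this
  · rw [if_neg hcut]
    refine (Finset.sum_eq_zero fun g _ => if_neg fun h => hcut ?_).le
    exact ⟨a, b, rfl, (hmem g h).2⟩

section Routing

variable {k : ℕ} {f : ℝ → ℝ}

/-- The edges of a routing that are neither close to the root nor far away from it, relative to
the scale `i`. -/
def windowEdges (r : X) (Q : Fin k → List X) (i : ℤ) : Finset (Sym2 X) :=
  (allEdges Q).filter fun e => (2 : ℝ) ^ i < edgeRadius r e ∧ edgeRadius r e ≤ 2 ^ i * k

lemma edgeLen_mul_card_cell_le (hf : IsCostFun f) {v : Fin k → X} {r : X} {c : ℕ → X}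
    {L : ℤ → X → ℕ} {Q : Fin k → List X}
    (hroot : ∀ i x, dist x r ≤ 2 ^ i → L i x = 0)
    (hdist : ∀ i s, dist (v s) (c (L i (v s))) ≤ 2 * 2 ^ i)
    (hQ : ∀ s, IsPath (v s) r (Q s)) (i : ℤ) (g : ℕ × ℕ) (T : Finset (Fin k))
    (hT : ∀ s ∈ T, cell L i (v s) = g ∧ pathLen (Q s) ≤ 2 ^ i * k) :
    edgeLen s(c g.1, c g.2) * f T.card ≤
      ∑ e ∈ windowEdges r Q i, if Crosses L i g e then 6 * 2 ^ i * f (load Q e) else 0 := by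
  have hpow : (0 : ℝ) < 2 ^ i := zpow_pos two_pos i
  have hpow' : (2 : ℝ) ^ (i + 1) = 2 ^ i * 2 := zpow_add_one₀ two_ne_zero i
  have hnonneg : 0 ≤ ∑ e ∈ windowEdges r Q i,
      if Crosses L i g e then 6 * 2 ^ i * f (load Q e) else 0 := by
    refine Finset.sum_nonneg fun e _ => ?_
    split_ifs
    · exact mul_nonneg (by positivity) (hf.nonneg _)
    · exact le_rfl
  have hnear : ∀ x, dist x r ≤ 2 ^ i → cell L i x = (0, 0) := by
    intro x hx
    rw [cell, hroot i x hx, hroot (i + 1) x (by rw [hpow']; linarith)]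
  by_cases hg : g = (0, 0)
  · simpa [hg, edgeLen_mk] using hg ▸ hnonneg
  rcases T.eq_empty_or_nonempty with rfl | ⟨s₀, hs₀⟩
  · simpa [hf.zero] using hnonneg
  have hlen : edgeLen s(c g.1, c g.2) ≤ 6 * 2 ^ i := by
    rw [← (hT s₀ hs₀).1, edgeLen_mk]
    have h1 := hdist i s₀
    have h2 := hdist (i + 1) s₀
    rw [hpow'] at h2
    have h3 := dist_triangle_left (c (L i (v s₀))) (c (L (i + 1) (v s₀))) (v s₀)
    simp only [cell]
    linarith
  rw [← Finset.sum_filter, ← Finset.mul_sum]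
  refine mul_le_mul hlen ?_ (hf.nonneg _) (by positivity)
  refine hf.card_le_sum _ _ (fun e => Finset.univ.filter fun s => e ∈ edgeList (Q s)) ?_
  intro s hs
  obtain ⟨hcell, hshort⟩ := hT s hs
  obtain ⟨a, b, hab, ha, hb⟩ := exists_crossing_edge (hQ s) (fun x => cell L i x = g) hcell
    (fun h => hg (h.symm.trans (hnear r (by simpa using hpow.le))))
  obtain ⟨ha', hb'⟩ := mem_of_mem_edgeList hab
  refine ⟨s(a, b), ?_, by simpa using hab⟩
  simp only [windowEdges, Finset.mem_filter]
  refine ⟨⟨mem_allEdges.2 ⟨s, hab⟩, ?_, ?_⟩, a, b, rfl, ha, hb⟩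
  · refine lt_of_lt_of_le (lt_of_not_ge fun h => hg ?_) (le_max_left _ _)
    exact ha.symm.trans (hnear a h)
  · exact max_le ((dist_le_pathLen (hQ s).2 ha').trans hshort)
      ((dist_le_pathLen (hQ s).2 hb').trans hshort)

/-- The cost of routing each terminal along the representatives of its cells, in terms of an
arbitrary routing `Q` and the edges of `Q` cut by the cells. -/
lemma costf_le_of_labelling (hf : IsCostFun f) (hk : 1 ≤ k) {v : Fin k → X} {r : X} {c : ℕ → X}
    {L : ℤ → X → ℕ} {P Q : Fin k → List X} {bot top : Fin k → ℤ}
    (hroot : ∀ i x, dist x r ≤ 2 ^ i → L i x = 0)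
    (hdist : ∀ i s, dist (v s) (c (L i (v s))) ≤ 2 * 2 ^ i)
    (hle : ∀ i s, L i (v s) ≤ k)
    (hQ : ∀ s, IsPath (v s) r (Q s))
    (hP : ∀ s, ∀ e ∈ edgeList (P s), e = s(v s, c (L (bot s) (v s))) ∨
      ∃ i, bot s ≤ i ∧ i < top s ∧ e = s(c (L i (v s)), c (L (i + 1) (v s))))
    {I : Finset ℤ} (hI : ∀ s i, bot s ≤ i → i < top s → i ∈ I) :
    costf f P ≤ ∑ s, dist (v s) (c (L (bot s) (v s))) * f 1 +
      (∑ s, ∑ i ∈ I.filter (fun i => (2 : ℝ) ^ i < pathLen (Q s) / k), 6 * 2 ^ i * f 1 +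
      ∑ i ∈ I, ∑ e ∈ windowEdges r Q i,
        if IsCut L i e then 12 * 2 ^ i * f (load Q e) else 0) := by
  have hk' : (0 : ℝ) < k := by exact_mod_cast hk
  have hf1 : 0 ≤ f 1 := by simpa using hf.nonneg 1
  let G : Finset (ℕ × ℕ) := Finset.range (k + 1) ×ˢ Finset.range (k + 1)
  let T : ℤ → ℕ × ℕ → Finset (Fin k) := fun i g =>
    Finset.univ.filter fun s => cell L i (v s) = g ∧ pathLen (Q s) ≤ 2 ^ i * k
  refine (costf_le_sum (γ := Fin k ⊕ (Fin k × ℤ) ⊕ (ℤ × ℕ × ℕ)) hf P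
    (Finset.univ.disjSum (((Finset.univ ×ˢ I).filter
      fun si : Fin k × ℤ => (2 : ℝ) ^ si.2 < pathLen (Q si.1) / k).disjSum (I ×ˢ G)))
    (Sum.elim (fun s => s(v s, c (L (bot s) (v s))))
      (Sum.elim (fun si => s(c (L si.2 (v si.1)), c (L (si.2 + 1) (v si.1))))
        (fun ig => s(c ig.2.1, c ig.2.2))))
    (Sum.elim (fun s => {s}) (Sum.elim (fun si => {si.1}) (fun ig => T ig.1 ig.2))) ?_).trans ?_
  · intro s e he
    rcases hP s e he with rfl | ⟨i, hi, hi', rfl⟩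
    · exact ⟨.inl s, by simp, rfl, by simp⟩
    · have hiI := hI s i hi hi'
      by_cases hbad : (2 : ℝ) ^ i < pathLen (Q s) / k
      · exact ⟨.inr (.inl (s, i)), by simp [hiI, hbad], rfl, by simp⟩
      · refine ⟨.inr (.inr (i, cell L i (v s))), ?_, rfl, ?_⟩
        · have h1 := hle i s
          have h2 := hle (i + 1) s
          simp [hiI, G, cell]
          omega
        · simpa [T, div_le_iff₀ hk'] using hbad
  · rw [Finset.sum_disjSum, Finset.sum_disjSum]
    simp only [Sum.elim_inl, Sum.elim_inr, Finset.card_singleton, Nat.cast_one, edgeLen_mk]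
    gcongr ?_ + (?_ + ?_)
    · exact le_rfl
    · rw [Finset.sum_filter, Finset.sum_product]
      simp only [← Finset.sum_filter]
      refine Finset.sum_le_sum fun s _ => Finset.sum_le_sum fun i _ => ?_
      refine mul_le_mul_of_nonneg_right ?_ hf1
      have h1 := hdist i s
      have h2 := hdist (i + 1) s
      rw [zpow_add_one₀ two_ne_zero] at h2
      linarith [dist_triangle_left (c (L i (v s))) (c (L (i + 1) (v s))) (v s)]
    · rw [Finset.sum_product]
      refine Finset.sum_le_sum fun i _ => ?_
      calc ∑ g ∈ G, dist (c g.1) (c g.2) * f (T i g).card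
          ≤ ∑ g ∈ G, ∑ e ∈ windowEdges r Q i,
              if Crosses L i g e then 6 * 2 ^ i * f (load Q e) else 0 :=
            Finset.sum_le_sum fun g _ => edgeLen_mul_card_cell_le hf hroot hdist hQ i g _
              fun s hs => (Finset.mem_filter.1 hs).2
        _ = ∑ e ∈ windowEdges r Q i, ∑ g ∈ G,
              if Crosses L i g e then 6 * 2 ^ i * f (load Q e) else 0 := Finset.sum_comm
        _ ≤ _ := by
            refine Finset.sum_le_sum fun e _ => ?_
            refine (sum_crosses_le L i e G
              (mul_nonneg (by positivity) (hf.nonneg _))).trans_eq ?_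
            congr 1
            ring

end Routing

/-! ### Random partitions -/

/-- The exponent governing how quickly the reach of the `t`-th centre decays. -/
def decayRate (t : ℕ) : ℕ := Nat.clog 2 (t + 2)

/-- The probability that the `t`-th centre reaches a point at normalised distance `a`. -/
def reachProb (t : ℕ) (a : ℝ) : ℝ :=
  if t = 0 then min 1 (max 0 (2 - a)) else min 1 (max 0 (1 - a)) ^ (3 * decayRate t)

lemma decayRate_pos (t : ℕ) : 0 < decayRate t := Nat.clog_pos one_lt_two (by omega)

lemma decayRate_mono : Monotone decayRate := fun _ _ h => Nat.clog_mono_right 2 (by omega)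

lemma reachProb_nonneg (t : ℕ) (a : ℝ) : 0 ≤ reachProb t a := by
  unfold reachProb
  split_ifs <;> positivity

lemma reachProb_le_one (t : ℕ) (a : ℝ) : reachProb t a ≤ 1 := by
  unfold reachProb
  split_ifs
  · exact min_le_left _ _
  · exact pow_le_one₀ (by positivity) (min_le_left _ _)

lemma reachProb_anti (t : ℕ) {a b : ℝ} (h : a ≤ b) : reachProb t b ≤ reachProb t a := by
  unfold reachProb
  split_ifs <;> gcongr

lemma reachProb_zero_right (t : ℕ) : reachProb t 0 = 1 := by
  unfold reachProb
  split_ifs <;> norm_num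

lemma reachProb_zero_left {a : ℝ} (h : a ≤ 1) : reachProb 0 a = 1 := by
  rw [reachProb, if_pos rfl, min_eq_left]
  exact le_max_of_le_right (by linarith)

lemma reachProb_of_two_le (t : ℕ) {a : ℝ} (h : 2 ≤ a) : reachProb t a = 0 := by
  unfold reachProb
  split_ifs
  · rw [max_eq_left (by linarith), min_eq_right zero_le_one]
  · rw [max_eq_left (by linarith), min_eq_right zero_le_one, zero_pow]
    have := decayRate_pos t
    omega

lemma pow_sub_pow_le_decay {x y δ : ℝ} (hy : 0 ≤ y) (hyx : y ≤ x) (hδ : x - y ≤ δ) (n : ℕ) :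
    x ^ n - y ^ n ≤ δ * (2 * n * x ^ n + 2 * n / 2 ^ n) := by
  have hx : 0 ≤ x := hy.trans hyx
  rcases n with _ | m
  · simp
  have hδ0 : 0 ≤ δ := le_trans (by linarith) hδ
  have h1 : x ^ (m + 1) - y ^ (m + 1) ≤ (x - y) * ((m + 1 : ℕ) * x ^ m) := by
    have := (le_abs_self _).trans (abs_pow_sub_pow_le x y (m + 1))
    rwa [abs_of_nonneg (sub_nonneg.2 hyx), abs_of_nonneg hx, abs_of_nonneg hy, max_eq_left hyx,
      Nat.add_sub_cancel, mul_assoc] at this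
  have h2 : x ^ m ≤ 2 * x ^ (m + 1) + 2 / 2 ^ (m + 1) := by
    rcases le_total (1 / 2) x with h | h
    · have : 0 ≤ x ^ m * (2 * x - 1) := mul_nonneg (by positivity) (by linarith)
      have h3 : (0 : ℝ) ≤ 2 / 2 ^ (m + 1) := by positivity
      rw [pow_succ x]
      linarith
    · have h3 : x ^ m ≤ (1 / 2) ^ m := by gcongr
      have h4 : (2 : ℝ) / 2 ^ (m + 1) = (1 / 2) ^ m := by
        rw [pow_succ, div_pow, one_pow]
        field_simp
      rw [h4]
      linarith [pow_nonneg hx (m + 1)]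
  calc _ ≤ (x - y) * ((m + 1 : ℕ) * x ^ m) := h1
    _ ≤ δ * ((m + 1 : ℕ) * (2 * x ^ (m + 1) + 2 / 2 ^ (m + 1))) := by gcongr
    _ = _ := by ring

lemma reachProb_sub_le (t : ℕ) {a b : ℝ} (hab : a ≤ b) :
    reachProb t a - reachProb t b ≤
      (b - a) * (6 * decayRate t * reachProb t a + 6 / (t + 2 : ℝ) ^ 2) := by
  have hclamp : ∀ u : ℝ, min 1 (max 0 (u - a)) - min 1 (max 0 (u - b)) ≤ b - a := by
    intro u
    rcases le_total 0 (u - b) with h | h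
    · rw [max_eq_right h, max_eq_right (by linarith)]
      have := min_le_right 1 (u - a)
      rcases min_cases 1 (u - b) with h' | h' <;> rcases min_cases 1 (u - a) with h'' | h'' <;>
        linarith
    · rw [max_eq_left h, min_eq_right zero_le_one]
      have : max 0 (u - a) ≤ b - a := max_le (by linarith) (by linarith)
      linarith [min_le_right 1 (max 0 (u - a))]
  have hd : 0 ≤ b - a := sub_nonneg.2 hab
  have hR := reachProb_nonneg t a
  by_cases ht : t = 0
  · subst ht
    have h1 : reachProb 0 a - reachProb 0 b ≤ b - a := by
      simpa [reachProb] using hclamp 2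
    refine h1.trans (le_mul_of_one_le_right hd ?_)
    have : (0 : ℝ) ≤ 6 * decayRate 0 * reachProb 0 a := by positivity
    have h6 : (1 : ℝ) ≤ 6 / ((0 : ℕ) + 2 : ℝ) ^ 2 := by norm_num
    linarith
  · set m := decayRate t with hm
    have h1 := pow_sub_pow_le_decay (x := min 1 (max 0 (1 - a))) (y := min 1 (max 0 (1 - b)))
      (by positivity) (by gcongr) (hclamp 1) (3 * m)
    have h2 : (2 * (3 * m : ℕ) / 2 ^ (3 * m) : ℝ) ≤ 6 / (t + 2 : ℝ) ^ 2 := by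
      have h3 : ((t + 2 : ℕ) : ℝ) ≤ (2 : ℝ) ^ m := by
        exact_mod_cast Nat.le_pow_clog one_lt_two (t + 2)
      have h4 : (m : ℝ) ≤ 2 ^ m := by exact_mod_cast Nat.lt_two_pow_self.le
      have h5 : (t + 2 : ℝ) ^ 2 ≤ (2 ^ m) ^ 2 := by
        push_cast at h3
        gcongr
      rw [div_le_div_iff₀ (by positivity) (by positivity), mul_comm 3 m, pow_mul]
      push_cast
      calc (2 * (m * 3) * (t + 2) ^ 2 : ℝ) = 6 * (m * (t + 2) ^ 2) := by ring
        _ ≤ 6 * (2 ^ m * (2 ^ m) ^ 2) := by gcongr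
        _ = _ := by ring
    have e1 : reachProb t a = min 1 (max 0 (1 - a)) ^ (3 * m) := by rw [reachProb, if_neg ht]
    have e2 : reachProb t b = min 1 (max 0 (1 - b)) ^ (3 * m) := by rw [reachProb, if_neg ht]
    rw [e1, e2]
    refine h1.trans (mul_le_mul_of_nonneg_left ?_ hd)
    refine add_le_add (le_of_eq ?_) h2
    push_cast
    ring

lemma sum_six_div_sq_le (n : ℕ) : ∑ t ∈ Finset.range n, 6 / (t + 2 : ℝ) ^ 2 ≤ 6 := by
  suffices h : ∑ t ∈ Finset.range n, 6 / (t + 2 : ℝ) ^ 2 ≤ 6 - 6 / (n + 1 : ℝ) by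
    have : (0 : ℝ) ≤ 6 / (n + 1) := by positivity
    linarith
  induction n with
  | zero => simp
  | succ n ih =>
    rw [Finset.sum_range_succ]
    have : (6 : ℝ) / (n + 2) ^ 2 ≤ 6 / (n + 1) - 6 / (n + 2) := by
      rw [div_sub_div _ _ (by positivity) (by positivity),
        div_le_div_iff₀ (by positivity) (by positivity)]
      have : (0 : ℝ) ≤ n := n.cast_nonneg
      nlinarith
    push_cast
    rw [show (n : ℝ) + 1 + 1 = n + 2 by ring]
    linarith

/-- If independent trials succeed with probabilities `q t`, and `w t` is bounded in terms of
`q t`, then the expectation of `w` at the first success is bounded. -/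
lemma sum_first_success_le {q w lam ε : ℕ → ℝ} {δ : ℝ} (hδ : 0 ≤ δ) (hq0 : ∀ t, 0 ≤ q t)
    (hq1 : ∀ t, q t ≤ 1) (hlam : Monotone lam) (hlam0 : ∀ t, 0 ≤ lam t) (hε : ∀ t, 0 ≤ ε t)
    (hw : ∀ t, w t ≤ δ * (lam t * q t + ε t)) (n : ℕ) :
    ∑ t ∈ Finset.range (n + 1), (∏ s ∈ Finset.range t, (1 - q s)) * w t ≤
      δ * (lam n + ∑ t ∈ Finset.range (n + 1), ε t) := by
  have hp0 : ∀ t, 0 ≤ ∏ s ∈ Finset.range t, (1 - q s) := fun t =>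
    Finset.prod_nonneg fun s _ => sub_nonneg.2 (hq1 s)
  have hp1 : ∀ t, ∏ s ∈ Finset.range t, (1 - q s) ≤ 1 := fun t =>
    Finset.prod_le_one (fun s _ => sub_nonneg.2 (hq1 s)) fun s _ => by linarith [hq0 s]
  have htel : ∀ m, ∑ t ∈ Finset.range m, (∏ s ∈ Finset.range t, (1 - q s)) * q t =
      1 - ∏ s ∈ Finset.range m, (1 - q s) := by
    intro m
    induction m with
    | zero => simp
    | succ m ih =>
      rw [Finset.sum_range_succ, ih, Finset.prod_range_succ]
      ring
  calc _ ≤ ∑ t ∈ Finset.range (n + 1),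
        δ * (lam n * ((∏ s ∈ Finset.range t, (1 - q s)) * q t) + ε t) := by
        refine Finset.sum_le_sum fun t ht => ?_
        have h1 := mul_le_mul_of_nonneg_left (hw t) (hp0 t)
        refine h1.trans ?_
        rw [mul_left_comm]
        refine mul_le_mul_of_nonneg_left ?_ hδ
        have h2 : lam t ≤ lam n := hlam (by simpa [Nat.lt_succ_iff] using ht)
        have h3 := mul_le_mul_of_nonneg_right h2 (mul_nonneg (hp0 t) (hq0 t))
        have h4 := mul_le_mul_of_nonneg_right (hp1 t) (hε t)
        linarith
    _ = δ * (lam n * (1 - ∏ s ∈ Finset.range (n + 1), (1 - q s)) +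
          ∑ t ∈ Finset.range (n + 1), ε t) := by
        rw [← Finset.mul_sum, Finset.sum_add_distrib, ← Finset.mul_sum, htel]
    _ ≤ _ := by
        refine mul_le_mul_of_nonneg_left ?_ hδ
        linarith [mul_nonneg (hlam0 n) (hp0 (n + 1))]

/-- The law of a sequence of independent uniform random variables. -/
def uniformSeq : Measure (ℕ → unitInterval) := Measure.infinitePi fun _ => volume

instance : IsProbabilityMeasure uniformSeq := by
  unfold uniformSeq
  infer_instance

/-- The values for which the `t`-th centre reaches points at normalised distance `a`. -/
def reachSet (t : ℕ) (a : ℝ) : Set unitInterval := {u | 0 < reachProb t a ∧ (u : ℝ) ≤ reachProb t a}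

lemma reachSet_anti (t : ℕ) {a b : ℝ} (h : a ≤ b) : reachSet t b ⊆ reachSet t a :=
  fun _ hu => ⟨hu.1.trans_le (reachProb_anti t h), hu.2.trans (reachProb_anti t h)⟩

lemma measurableSet_reachSet (t : ℕ) (a : ℝ) : MeasurableSet (reachSet t a) :=
  (MeasurableSet.const _).inter (measurableSet_le measurable_subtype_coe measurable_const)

lemma volume_real_reachSet (t : ℕ) (a : ℝ) :
    (volume : Measure unitInterval).real (reachSet t a) = reachProb t a := by
  have h0 := reachProb_nonneg t a
  rcases h0.eq_or_lt with h | h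
  · simp [reachSet, ← h]
  · have : reachSet t a = Set.Iic ⟨reachProb t a, h0, reachProb_le_one t a⟩ := by
      ext u
      simp [reachSet, h, ← Subtype.coe_le_coe]
    rw [this, measureReal_def, unitInterval.volume_Iic, ENNReal.toReal_ofReal h0]

/-- The `t`-th centre reaches the point `x` at scale `σ`. -/
def Reaches (ω : ℕ → unitInterval) (c : ℕ → X) (σ : ℝ) (t : ℕ) (x : X) : Prop :=
  ω t ∈ reachSet t (dist x (c t) / σ)

lemma exists_lt_or_reaches (ω : ℕ → unitInterval) (c : ℕ → X) (σ : ℝ) (n : ℕ) (x : X) :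
    ∃ t, n < t ∨ Reaches ω c σ t x := ⟨n + 1, .inl n.lt_succ_self⟩

/-- The index of the first of the centres `c 0, …, c n` reaching `x` at scale `σ`, or `n + 1` if
there is none. -/
def label (ω : ℕ → unitInterval) (c : ℕ → X) (σ : ℝ) (n : ℕ) (x : X) : ℕ :=
  Nat.find (exists_lt_or_reaches ω c σ n x)

lemma reaches_center (ω : ℕ → unitInterval) (c : ℕ → X) (σ : ℝ) (t : ℕ) :
    Reaches ω c σ t (c t) := by
  simp [Reaches, reachSet, reachProb_zero_right, (ω t).2.2]

lemma label_center_le (ω : ℕ → unitInterval) (c : ℕ → X) (σ : ℝ) {n t : ℕ} :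
    label ω c σ n (c t) ≤ t :=
  Nat.find_min' _ (.inr (reaches_center ω c σ t))

lemma label_eq_zero (ω : ℕ → unitInterval) (c : ℕ → X) {σ : ℝ} (hσ : 0 < σ) (n : ℕ) {x : X}
    (h : dist x (c 0) ≤ σ) : label ω c σ n x = 0 := by
  rw [label, Nat.find_eq_zero]
  right
  simp [Reaches, reachSet, reachProb_zero_left ((div_le_one hσ).2 h), (ω 0).2.2]

lemma dist_label_lt (ω : ℕ → unitInterval) (c : ℕ → X) {σ : ℝ} (hσ : 0 < σ) {n : ℕ} {x : X}
    (h : label ω c σ n x ≤ n) : dist x (c (label ω c σ n x)) < 2 * σ := by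
  have hs := (Nat.find_spec (exists_lt_or_reaches ω c σ n x)).resolve_left h.not_gt
  refine lt_of_not_ge fun h' => ?_
  exact absurd (reachProb_of_two_le _ ((le_div_iff₀ hσ).2 h')) hs.1.ne'

lemma label_congr (ω : ℕ → unitInterval) {c c' : ℕ → X} (σ : ℝ) {n n' m : ℕ} (hn : m ≤ n)
    (hn' : m ≤ n') (hc : ∀ t ≤ m, c t = c' t) :
    label ω c σ n (c m) = label ω c' σ n' (c m) := by
  have h1 : label ω c σ n (c m) ≤ m := label_center_le ω c σ
  have h2 : label ω c' σ n' (c m) ≤ m := by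
    rw [hc m le_rfl]
    exact label_center_le ω c' σ
  have hR : ∀ t ≤ m, Reaches ω c σ t (c m) ↔ Reaches ω c' σ t (c m) := fun t ht => by
    rw [Reaches, Reaches, hc t ht]
  refine le_antisymm (Nat.find_min' _ (.inr ?_)) (Nat.find_min' _ (.inr ?_))
  · exact (hR _ h2).2 ((Nat.find_spec (exists_lt_or_reaches ω c' σ n' (c m))).resolve_left
      (h2.trans hn').not_gt)
  · exact (hR _ h1).1 ((Nat.find_spec (exists_lt_or_reaches ω c σ n (c m))).resolve_left
      (h1.trans hn).not_gt)

lemma measurable_label (c : ℕ → X) (σ : ℝ) (n : ℕ) (x : X) :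
    Measurable fun ω => label ω c σ n x :=
  measurable_find _ fun t => by
    rw [Set.ofPred_or]
    exact (MeasurableSet.const _).union
      ((measurableSet_reachSet t (dist x (c t) / σ)).preimage (measurable_pi_apply t))

lemma uniformSeq_real_first_success (A : ℕ → Set unitInterval) (B : Set unitInterval) (t : ℕ)
    (hA : ∀ s, MeasurableSet (A s)) (hB : MeasurableSet B) :
    uniformSeq.real {ω | (∀ s < t, ω s ∉ A s) ∧ ω t ∈ B} =
      (∏ s ∈ Finset.range t, (1 - (volume : Measure unitInterval).real (A s))) *
        (volume : Measure unitInterval).real B := by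
  have hset : {ω : ℕ → unitInterval | (∀ s < t, ω s ∉ A s) ∧ ω t ∈ B} =
      Set.pi (Finset.range (t + 1)) fun s => if s = t then B else (A s)ᶜ := by
    ext ω
    simp only [Set.mem_ofPred_eq, Set.mem_pi, Finset.coe_range, Set.mem_Iio]
    refine ⟨fun h s hs => ?_, fun h => ⟨fun s hs => ?_, ?_⟩⟩
    · split_ifs with hst
      · exact hst ▸ h.2
      · exact h.1 s (by omega)
    · have := h s (by omega)
      rwa [if_neg hs.ne] at this
    · simpa using h t (by omega)
  rw [hset, measureReal_def, uniformSeq, Measure.infinitePi_pi, Finset.prod_range_succ, if_pos rfl,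
    ENNReal.toReal_mul, ENNReal.toReal_prod]
  · congr 1
    refine Finset.prod_congr rfl fun s hs => ?_
    rw [if_neg (Finset.mem_range.1 hs).ne, ← measureReal_def, probReal_compl_eq_one_sub (hA s)]
  · intro s _
    split_ifs
    exacts [hB, (hA s).compl]

lemma uniformSeq_real_label_ne_le (c : ℕ → X) {σ : ℝ} (hσ : 0 < σ) (n : ℕ) (x y : X) :
    uniformSeq.real {ω | label ω c σ n x ≠ label ω c σ n y} ≤
      dist x y / σ * (6 * decayRate n + 6) := by
  let α : ℕ → ℝ := fun t => dist x (c t) / σ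
  let β : ℕ → ℝ := fun t => dist y (c t) / σ
  let A : ℕ → Set unitInterval := fun t => reachSet t (min (α t) (β t))
  let B : ℕ → Set unitInterval := fun t => A t \ reachSet t (max (α t) (β t))
  have hA : ∀ t, MeasurableSet (A t) := fun t => measurableSet_reachSet t _
  have hsub : {ω | label ω c σ n x ≠ label ω c σ n y} ⊆
      ⋃ t ∈ Finset.range (n + 1), {ω | (∀ s < t, ω s ∉ A s) ∧ ω t ∈ B t} := by
    have hfar : ∀ (ω : ℕ → unitInterval) s, ¬ Reaches ω c σ s x → ¬ Reaches ω c σ s y → ω s ∉ A s := by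
      intro ω s hx hy hs
      rcases min_choice (α s) (β s) with h | h
      · simp only [A, h] at hs
        exact hx hs
      · simp only [A, h] at hs
        exact hy hs
    have key : ∀ ω, ∀ x' y' : X, (x' = x ∧ y' = y ∨ x' = y ∧ y' = x) →
        label ω c σ n x' < label ω c σ n y' →
        ω ∈ ⋃ t ∈ Finset.range (n + 1), {ω | (∀ s < t, ω s ∉ A s) ∧ ω t ∈ B t} := by
      intro ω x' y' hxy hlt
      have hle : label ω c σ n y' ≤ n + 1 := Nat.find_min' _ (.inl n.lt_succ_self)
      have hx : Reaches ω c σ (label ω c σ n x') x' :=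
        (Nat.find_spec (exists_lt_or_reaches ω c σ n x')).resolve_left
          (fun h => by unfold label at hlt hle; omega)
      have hy : ¬ Reaches ω c σ (label ω c σ n x') y' := fun h =>
        Nat.find_min (exists_lt_or_reaches ω c σ n y') hlt (.inr h)
      have hx' : ∀ s < label ω c σ n x', ¬ Reaches ω c σ s x' := fun s hs h =>
        Nat.find_min (exists_lt_or_reaches ω c σ n x') hs (.inr h)
      have hy' : ∀ s < label ω c σ n x', ¬ Reaches ω c σ s y' := fun s hs h =>
        Nat.find_min (exists_lt_or_reaches ω c σ n y') (hs.trans hlt) (.inr h)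
      simp only [Set.mem_iUnion, Finset.mem_range]
      refine ⟨label ω c σ n x', by omega, ?_⟩
      rcases hxy with ⟨rfl, rfl⟩ | ⟨rfl, rfl⟩
      · exact ⟨fun s hs => hfar ω s (hx' s hs) (hy' s hs), reachSet_anti _ (min_le_left _ _) hx,
          fun h => hy (reachSet_anti _ (le_max_right _ _) h)⟩
      · exact ⟨fun s hs => hfar ω s (hy' s hs) (hx' s hs), reachSet_anti _ (min_le_right _ _) hx,
          fun h => hy (reachSet_anti _ (le_max_left _ _) h)⟩
    intro ω hω
    rcases lt_or_gt_of_ne hω with h | h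
    · exact key ω x y (.inl ⟨rfl, rfl⟩) h
    · exact key ω y x (.inr ⟨rfl, rfl⟩) h
  have hδ : ∀ t, max (α t) (β t) - min (α t) (β t) ≤ dist x y / σ := by
    intro t
    rw [max_sub_min_eq_abs, ← sub_div, abs_div, abs_of_pos hσ, abs_sub_comm]
    gcongr
    exact abs_dist_sub_le x y (c t)
  have hB : ∀ t, (volume : Measure unitInterval).real (B t) =
      reachProb t (min (α t) (β t)) - reachProb t (max (α t) (β t)) := by
    intro t
    rw [measureReal_sdiff (reachSet_anti t min_le_max) (measurableSet_reachSet t _),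
      volume_real_reachSet, volume_real_reachSet]
  calc _ ≤ uniformSeq.real
        (⋃ t ∈ Finset.range (n + 1), {ω | (∀ s < t, ω s ∉ A s) ∧ ω t ∈ B t}) :=
        measureReal_mono hsub (measure_ne_top _ _)
    _ ≤ ∑ t ∈ Finset.range (n + 1), uniformSeq.real {ω | (∀ s < t, ω s ∉ A s) ∧ ω t ∈ B t} :=
        measureReal_biUnion_finset_le _ _
    _ = ∑ t ∈ Finset.range (n + 1),
          (∏ s ∈ Finset.range t, (1 - reachProb s (min (α s) (β s)))) *
          (reachProb t (min (α t) (β t)) - reachProb t (max (α t) (β t))) := by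
        refine Finset.sum_congr rfl fun t _ => ?_
        rw [uniformSeq_real_first_success A (B t) t hA
          ((hA t).diff (measurableSet_reachSet t _)), hB]
        simp only [A, volume_real_reachSet]
    _ ≤ dist x y / σ * (6 * decayRate n + ∑ t ∈ Finset.range (n + 1), 6 / (t + 2 : ℝ) ^ 2) := by
        refine sum_first_success_le (q := fun t => reachProb t (min (α t) (β t)))
          (lam := fun t => 6 * (decayRate t : ℝ)) (ε := fun t => 6 / (t + 2 : ℝ) ^ 2)
          (by positivity) (fun t => reachProb_nonneg t _) (fun t => reachProb_le_one t _)
          (fun a b h => ?_) (fun t => by positivity) (fun t => by positivity) (fun t => ?_) n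
        · have : (decayRate a : ℝ) ≤ decayRate b := by exact_mod_cast decayRate_mono h
          linarith
        · refine (reachProb_sub_le t min_le_max).trans
            (mul_le_mul_of_nonneg_right (hδ t) ?_)
          have := reachProb_nonneg t (min (α t) (β t))
          positivity
    _ ≤ _ := by
        gcongr
        exact sum_six_div_sq_le _

/-! ### The online algorithm -/

/-- The root followed by the points of the list. -/
def centers (r : X) (l : List X) (t : ℕ) : X := (r :: l).getD t r

/-- The scale at which the terminal `x` lies in the cell of the root. -/
def topScale (r x : X) : ℤ := Int.clog 2 (dist x r)

/-- The path of a terminal `x` through the centres of its cells at the scales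
`topScale r x - n, …, topScale r x`. -/
def scalePath (ω : ℕ → unitInterval) (c : ℕ → X) (n m : ℕ) (r x : X) : List X :=
  x :: (List.range (n + 1)).map fun j : ℕ =>
    c (label ω c (2 ^ (topScale r x - n + j)) m x)

/-- The online algorithm: the path of the last terminal of the list. -/
def route (r : X) (ω : ℕ → unitInterval) (l : List X) : List X :=
  l.getLast?.elim [] (scalePath ω (centers r l) l.length l.length r)

lemma topScale_spec (r x : X) : dist x r ≤ 2 ^ topScale r x := by
  simpa [topScale] using Int.self_le_zpow_clog one_lt_two (dist x r)

lemma isPath_scalePath (ω : ℕ → unitInterval) {c : ℕ → X} {r : X} (hc : c 0 = r) (n m : ℕ)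
    (x : X) : IsPath x r (scalePath ω c n m r x) := by
  have h : label ω c (2 ^ topScale r x) m x = 0 :=
    label_eq_zero ω c (zpow_pos two_pos _) m (hc ▸ topScale_spec r x)
  refine ⟨rfl, ?_⟩
  rw [scalePath, List.range_succ, List.map_append]
  simp [h, hc, List.getLast?_cons]

lemma isPath_route (r : X) (ω : ℕ → unitInterval) (l : List X) (x : X) :
    IsPath x r (route r ω (l ++ [x])) := by
  have h := isPath_scalePath ω (c := centers r (l ++ [x])) (r := r) rfl
    (l ++ [x]).length (l ++ [x]).length x
  simpa [route] using h

section Analysis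

variable {k : ℕ} {f : ℝ → ℝ}

lemma centers_ofFn_succ (r : X) (v : Fin k → X) (s : Fin k) :
    centers r (List.ofFn v) (s + 1) = v s := by
  simp [centers]

lemma route_take (r : X) (v : Fin k → X) (ω : ℕ → unitInterval) (s : Fin k) :
    route r ω ((List.ofFn v).take (s + 1)) =
      scalePath ω (centers r (List.ofFn v)) (s + 1) k r (v s) := by
  have hlen : ((List.ofFn v).take (s + 1)).length = s + 1 := by
    simp only [List.length_take, List.length_ofFn]
    omega
  have hlast : ((List.ofFn v).take (s + 1)).getLast? = some (v s) := by
    rw [List.getLast?_eq_getElem?, hlen]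
    simp
  have hc : ∀ t ≤ (s : ℕ) + 1, centers r ((List.ofFn v).take (s + 1)) t =
      centers r (List.ofFn v) t := by
    intro t ht
    cases t with
    | zero => rfl
    | succ t =>
      simp only [centers, List.getD_eq_getElem?_getD, List.getElem?_cons_succ,
        List.getElem?_take, if_pos (show t < (s : ℕ) + 1 by omega)]
  have hs := centers_ofFn_succ r v s
  rw [route, hlast, hlen, Option.elim_some, scalePath, scalePath]
  congr 1
  refine List.map_congr_left fun j _ => ?_
  have hlab := label_congr ω (c := centers r ((List.ofFn v).take (s + 1)))
    (c' := centers r (List.ofFn v)) (2 ^ (topScale r (v s) - ((s : ℕ) + 1 : ℕ) + j)) le_rfl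
    (Nat.succ_le_of_lt s.2) hc
  have hle := label_center_le ω (centers r (List.ofFn v))
    (2 ^ (topScale r (v s) - ((s : ℕ) + 1 : ℕ) + j)) (n := k) (t := s + 1)
  rw [hc _ le_rfl, hs] at hlab
  rw [hs] at hle
  rw [hlab, hc _ hle]

lemma isCut_mk (L : ℤ → X → ℕ) (i : ℤ) (a b : X) :
    IsCut L i s(a, b) ↔ L i a ≠ L i b ∨ L (i + 1) a ≠ L (i + 1) b := by
  have : IsCut L i s(a, b) ↔ cell L i a ≠ cell L i b := by
    refine ⟨?_, fun h => ⟨a, b, rfl, h⟩⟩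
    rintro ⟨a', b', he, h⟩
    rcases Sym2.eq_iff.1 he with ⟨rfl, rfl⟩ | ⟨rfl, rfl⟩
    exacts [h, h.symm]
  rw [this, cell, cell, Ne, Prod.mk.injEq, not_and_or]

lemma measurableSet_label_ne (c : ℕ → X) (σ : ℝ) (n : ℕ) (a b : X) :
    MeasurableSet {ω | label ω c σ n a ≠ label ω c σ n b} :=
  (measurableSet_eq_fun (measurable_label c σ n a) (measurable_label c σ n b)).compl

lemma setOf_isCut_mk (c : ℕ → X) (n : ℕ) (i : ℤ) (a b : X) :
    {ω | IsCut (fun j x => label ω c (2 ^ j) n x) i s(a, b)} =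
      {ω | label ω c (2 ^ i) n a ≠ label ω c (2 ^ i) n b} ∪
        {ω | label ω c (2 ^ (i + 1)) n a ≠ label ω c (2 ^ (i + 1)) n b} := by
  ext ω
  exact isCut_mk _ i a b

lemma measurableSet_isCut (c : ℕ → X) (n : ℕ) (i : ℤ) (e : Sym2 X) :
    MeasurableSet {ω | IsCut (fun j x => label ω c (2 ^ j) n x) i e} := by
  induction e with | _ a b
  rw [setOf_isCut_mk]
  exact (measurableSet_label_ne c _ n a b).union (measurableSet_label_ne c _ n a b)

lemma uniformSeq_real_isCut_le (c : ℕ → X) (n : ℕ) (i : ℤ) (e : Sym2 X) :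
    uniformSeq.real {ω | IsCut (fun j x => label ω c (2 ^ j) n x) i e} ≤
      edgeLen e / 2 ^ i * (9 * (decayRate n + 1)) := by
  induction e with | _ a b
  have hi : (0 : ℝ) < 2 ^ i := zpow_pos two_pos i
  rw [setOf_isCut_mk, edgeLen_mk]
  refine (measureReal_union_le _ _).trans ((add_le_add
    (uniformSeq_real_label_ne_le c hi n a b)
    (uniformSeq_real_label_ne_le c (zpow_pos two_pos (i + 1)) n a b)).trans_eq ?_)
  rw [zpow_add_one₀ two_ne_zero]
  field_simp
  ring

lemma decayRate_le (hk : 1 ≤ k) : (decayRate k : ℝ) ≤ 3 + Real.logb 2 k := by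
  have hk' : (0 : ℝ) < k := by exact_mod_cast hk
  obtain ⟨p, hp⟩ : ∃ p, p = Nat.clog 2 (2 ^ 2 * k) - 1 := ⟨_, rfl⟩
  have h1 : decayRate k ≤ Nat.clog 2 (2 ^ 2 * k) := Nat.clog_mono_right 2 (by omega)
  have h2 : (2 : ℕ) ^ p < 2 ^ 2 * k := hp ▸ Nat.pow_pred_clog_lt_self one_lt_two (by omega)
  have h3 : (2 : ℝ) ^ p < 2 ^ 2 * k := by exact_mod_cast h2
  have h4 := Real.logb_lt_logb one_lt_two (by positivity) h3
  rw [Real.logb_mul (by positivity) hk'.ne', Real.logb_pow, Real.logb_pow,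
    Real.logb_self_eq_one one_lt_two] at h4
  have h5 : (decayRate k : ℝ) ≤ p + 1 := by
    exact_mod_cast (by omega : decayRate k ≤ p + 1)
  push_cast at h4
  linarith

lemma measurable_costf_scalePath (f : ℝ → ℝ) (v : Fin k → X) (r : X) (c : ℕ → X) :
    Measurable fun ω => costf f fun s : Fin k => scalePath ω c (s + 1) k r (v s) := by
  let F : (Fin k → Fin (k + 1) → ℕ) → ℝ := fun g => costf f fun s : Fin k =>
    v s :: (List.range (s + 1 + 1)).map fun j : ℕ => c (g s (Fin.ofNat (k + 1) j))
  have hF : Measurable F := Measurable.of_discrete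
  have hg : Measurable fun (ω : ℕ → unitInterval) (s : Fin k) (j : Fin (k + 1)) =>
      label ω c (2 ^ (topScale r (v s) - ((s : ℕ) + 1 : ℕ) + (j : ℕ))) k (v s) :=
    measurable_pi_lambda _ fun s => measurable_pi_lambda _ fun j => measurable_label _ _ _ _
  convert hF.comp hg using 1
  funext ω
  simp only [F, Function.comp_apply, scalePath]
  congr 1
  funext s
  congr 1
  refine List.map_congr_left fun j hj => ?_
  rw [List.mem_range] at hj
  rw [Fin.val_ofNat, Nat.mod_eq_of_lt (by omega)]

lemma dist_bottom_label_le (ω : ℕ → unitInterval) {c : ℕ → X} {r : X} (hc : c 0 = r) {n m : ℕ}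
    {x : X} (h : ∀ σ, label ω c σ m x ≤ m) :
    dist x (c (label ω c (2 ^ (topScale r x - n)) m x)) ≤ 4 * (1 / 2) ^ n * dist x r := by
  have hpos : (0 : ℝ) < 2 ^ (topScale r x - n) := zpow_pos two_pos _
  rcases (dist_nonneg : 0 ≤ dist x r).eq_or_lt with h0 | h0
  · rw [label_eq_zero ω c hpos m (by rw [hc, ← h0]; exact hpos.le), hc, ← h0, mul_zero]
  · refine (dist_label_lt ω c hpos (h _)).le.trans ?_
    have h1 := Int.zpow_pred_clog_lt_self (b := 2) one_lt_two h0
    rw [Nat.cast_ofNat, zpow_sub_one₀ two_ne_zero] at h1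
    have h2 : (2 : ℝ) ^ topScale r x ≤ 2 * dist x r := by
      rw [topScale]
      linarith
    rw [zpow_sub₀ two_ne_zero, zpow_natCast, div_eq_mul_inv, one_div, inv_pow]
    have : (0 : ℝ) < (2 ^ n)⁻¹ := by positivity
    nlinarith

lemma sum_half_pow_succ_le (k : ℕ) : ∑ s : Fin k, (1 / 2 : ℝ) ^ ((s : ℕ) + 1) ≤ 1 := by
  rw [Fin.sum_univ_eq_sum_range fun s => (1 / 2 : ℝ) ^ (s + 1)]
  simp only [pow_succ, ← Finset.sum_mul]
  linarith [sum_geometric_two_le k]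

/-- Pointwise bound on the cost of the algorithm by a fixed part and a part paid for the edges cut
by the random partitions. -/
lemma costf_scalePath_le (hf : IsCostFun f) (hk : 1 ≤ k) {v : Fin k → X} {r : X} {c : ℕ → X}
    (hc : c 0 = r) (hcv : ∀ s : Fin k, c (s + 1) = v s) {Q : Fin k → List X}
    (hQ : ∀ s, IsPath (v s) r (Q s)) (ω : ℕ → unitInterval) {I : Finset ℤ}
    (hI : ∀ s i, topScale r (v s) - ((s : ℕ) + 1 : ℕ) ≤ i → i < topScale r (v s) → i ∈ I) :
    costf f (fun s : Fin k => scalePath ω c (s + 1) k r (v s)) ≤ 16 * costf f Q +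
      ∑ i ∈ I, ∑ e ∈ windowEdges r Q i,
        if IsCut (fun j x => label ω c (2 ^ j) k x) i e then 12 * 2 ^ i * f (load Q e) else 0 := by
  have hf1 : 0 ≤ f 1 := by simpa using hf.nonneg 1
  have hk' : (0 : ℝ) < k := by exact_mod_cast hk
  have hle : ∀ (s : Fin k) σ, label ω c σ k (v s) ≤ k := fun s σ =>
    (hcv s ▸ label_center_le ω c σ).trans s.2
  have hpow : ∀ i : ℤ, (0 : ℝ) < 2 ^ i := zpow_pos two_pos
  refine (costf_le_of_labelling hf hk (r := r) (c := c)
    (L := fun j x => label ω c (2 ^ j) k x)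
    (bot := fun s => topScale r (v s) - ((s : ℕ) + 1 : ℕ)) (top := fun s => topScale r (v s))
    (fun i x hx => label_eq_zero ω c (hpow i) k (hc ▸ hx))
    (fun i s => (dist_label_lt ω c (hpow i) (hle s _)).le) (fun i s => hle s _) hQ ?_ hI).trans ?_
  · intro s e he
    rcases mem_edgeList_cons_map_range _ _ _ he with rfl | ⟨j, hj, rfl⟩
    · left
      simp
    · right
      refine ⟨topScale r (v s) - ((s : ℕ) + 1 : ℕ) + j, by omega, by omega, ?_⟩
      simp [add_assoc]
  · rw [← add_assoc]
    gcongr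
    have h1 : ∑ s, dist (v s) (c (label ω c (2 ^ (topScale r (v s) - ((s : ℕ) + 1 : ℕ))) k (v s)))
        * f 1 ≤ 4 * costf f Q := by
      calc _ ≤ ∑ s : Fin k, 4 * costf f Q * (1 / 2) ^ ((s : ℕ) + 1) := by
            refine Finset.sum_le_sum fun s _ => ?_
            have ha := mul_le_mul_of_nonneg_right
              (dist_bottom_label_le ω hc (n := s + 1) (hle s)) hf1
            have hb : dist (v s) r * f 1 ≤ costf f Q :=
              (mul_le_mul_of_nonneg_right (dist_le_pathLen (hQ s).2
                (List.mem_of_mem_head? (hQ s).1)) hf1).trans (pathLen_mul_le_costf hf Q s)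
            have hd : (0 : ℝ) ≤ 4 * (1 / 2) ^ ((s : ℕ) + 1) := by positivity
            have he := mul_le_mul_of_nonneg_left hb hd
            linarith
        _ ≤ _ := by
            rw [← Finset.mul_sum]
            exact mul_le_of_le_one_right (mul_nonneg (by norm_num) (costf_nonneg hf Q))
              (sum_half_pow_succ_le k)
    have h2 : ∑ s, ∑ i ∈ I.filter (fun i => (2 : ℝ) ^ i < pathLen (Q s) / k), 6 * 2 ^ i * f 1 ≤
        12 * costf f Q := by
      calc _ ≤ ∑ _s : Fin k, 12 * costf f Q / k := by
            refine Finset.sum_le_sum fun s _ => ?_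
            rw [← Finset.sum_mul, ← Finset.mul_sum]
            have ha := sum_two_zpow_filter_le I (div_nonneg (pathLen_nonneg (Q s)) hk'.le)
            calc _ ≤ 6 * (2 * (pathLen (Q s) / k)) * f 1 := by gcongr
              _ = 12 * (pathLen (Q s) * f 1) / k := by ring
              _ ≤ _ := by
                gcongr
                exact pathLen_mul_le_costf hf Q s
        _ = _ := by
            rw [Finset.sum_const, Finset.card_univ, Fintype.card_fin, nsmul_eq_mul]
            field_simp
    linarith

lemma sum_windowEdges_le (hf : IsCostFun f) (hk : 1 ≤ k) (r : X) (Q : Fin k → List X)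
    (I : Finset ℤ) :
    ∑ i ∈ I, ∑ e ∈ windowEdges r Q i, edgeLen e * f (load Q e) ≤
      (1 + Real.logb 2 k) * costf f Q := by
  have hk' : (1 : ℝ) ≤ k := by exact_mod_cast hk
  simp only [windowEdges, Finset.sum_filter]
  rw [Finset.sum_comm, costf, Finset.mul_sum]
  refine Finset.sum_le_sum fun e _ => ?_
  rw [← Finset.sum_filter, Finset.sum_const, nsmul_eq_mul]
  exact mul_le_mul_of_nonneg_right (card_dyadic_window_le I _ hk')
    (mul_nonneg (edgeLen_nonneg e) (hf.nonneg _))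

lemma integral_costf_scalePath_le (hf : IsCostFun f) (hk : 1 ≤ k) {v : Fin k → X} {r : X}
    {c : ℕ → X} (hc : c 0 = r) (hcv : ∀ s : Fin k, c (s + 1) = v s) {Q : Fin k → List X}
    (hQ : ∀ s, IsPath (v s) r (Q s)) :
    Integrable (fun ω => costf f fun s : Fin k => scalePath ω c (s + 1) k r (v s)) uniformSeq ∧
      ∫ ω, costf f (fun s : Fin k => scalePath ω c (s + 1) k r (v s)) ∂uniformSeq ≤
        448 * (1 + Real.logb 2 k) ^ 2 * costf f Q := by
  let I : Finset ℤ := Finset.univ.biUnion fun s : Fin k =>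
    Finset.Ico (topScale r (v s) - ((s : ℕ) + 1 : ℕ)) (topScale r (v s))
  have hI : ∀ s i, topScale r (v s) - ((s : ℕ) + 1 : ℕ) ≤ i → i < topScale r (v s) → i ∈ I :=
    fun s i h h' => Finset.mem_biUnion.2 ⟨s, Finset.mem_univ s, Finset.mem_Ico.2 ⟨h, h'⟩⟩
  let K : ℤ → Sym2 X → ℝ := fun i e => 12 * 2 ^ i * f (load Q e)
  let S : ℤ → Sym2 X → Set (ℕ → unitInterval) := fun i e =>
    {ω | IsCut (fun j x => label ω c (2 ^ j) k x) i e}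
  have hind : ∀ i e, Integrable ((S i e).indicator fun _ => K i e) uniformSeq := fun i e =>
    (integrable_const _).indicator (measurableSet_isCut c k i e)
  have hsum : Integrable (fun ω => ∑ i ∈ I, ∑ e ∈ windowEdges r Q i,
      (S i e).indicator (fun _ => K i e) ω) uniformSeq :=
    integrable_finsetSum _ fun i _ => integrable_finsetSum _ fun e _ => hind i e
  have hbound : Integrable (fun ω => 16 * costf f Q + ∑ i ∈ I, ∑ e ∈ windowEdges r Q i,
      (S i e).indicator (fun _ => K i e) ω) uniformSeq := (integrable_const _).add hsum
  have hpt : ∀ ω, costf f (fun s : Fin k => scalePath ω c (s + 1) k r (v s)) ≤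
      16 * costf f Q + ∑ i ∈ I, ∑ e ∈ windowEdges r Q i,
        (S i e).indicator (fun _ => K i e) ω := by
    intro ω
    refine (costf_scalePath_le hf hk hc hcv hQ ω hI).trans_eq ?_
    simp only [Set.indicator_apply]
    rfl
  have hint : Integrable (fun ω => costf f fun s : Fin k => scalePath ω c (s + 1) k r (v s))
      uniformSeq := by
    refine hbound.mono' (measurable_costf_scalePath f v r c).aestronglyMeasurable
      (Filter.Eventually.of_forall fun ω => ?_)
    rw [Real.norm_of_nonneg (costf_nonneg hf _)]
    exact hpt ω
  refine ⟨hint, (integral_mono hint hbound hpt).trans ?_⟩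
  have hlog : 0 ≤ Real.logb 2 k := Real.logb_nonneg one_lt_two (by exact_mod_cast hk)
  have hQ0 := costf_nonneg hf Q
  have hterm : ∀ i e, ∫ ω, (S i e).indicator (fun _ => K i e) ω ∂uniformSeq ≤
      108 * (decayRate k + 1) * (edgeLen e * f (load Q e)) := by
    intro i e
    have hi : (0 : ℝ) < 2 ^ i := zpow_pos two_pos i
    rw [integral_indicator_const _ (measurableSet_isCut c k i e), smul_eq_mul]
    calc _ ≤ edgeLen e / 2 ^ i * (9 * (decayRate k + 1)) * K i e :=
          mul_le_mul_of_nonneg_right (uniformSeq_real_isCut_le c k i e)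
            (mul_nonneg (by positivity) (hf.nonneg _))
      _ = _ := by
          simp only [K]
          field_simp
          ring
  rw [integral_add (integrable_const _) hsum, integral_const, probReal_univ, one_smul,
    integral_finsetSum _ fun i _ => integrable_finsetSum _ fun e _ => hind i e]
  have h1 : ∑ i ∈ I, ∫ ω, ∑ e ∈ windowEdges r Q i, (S i e).indicator (fun _ => K i e) ω
      ∂uniformSeq ≤ 108 * (decayRate k + 1) * ((1 + Real.logb 2 k) * costf f Q) := by
    calc _ ≤ ∑ i ∈ I, 108 * (decayRate k + 1) *
          ∑ e ∈ windowEdges r Q i, edgeLen e * f (load Q e) := by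
          refine Finset.sum_le_sum fun i _ => ?_
          rw [integral_finsetSum _ fun e _ => hind i e, Finset.mul_sum]
          exact Finset.sum_le_sum fun e _ => hterm i e
      _ ≤ _ := by
          rw [← Finset.mul_sum]
          exact mul_le_mul_of_nonneg_left (sum_windowEdges_le hf hk r Q I) (by positivity)
  have h2 := decayRate_le hk
  have h3 : 108 * (decayRate k + 1) * ((1 + Real.logb 2 k) * costf f Q) ≤
      432 * (1 + Real.logb 2 k) * ((1 + Real.logb 2 k) * costf f Q) := by
    refine mul_le_mul_of_nonneg_right ?_ (by positivity)
    linarith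
  have h4 : costf f Q ≤ (1 + Real.logb 2 k) ^ 2 * costf f Q :=
    le_mul_of_one_le_left hQ0 (one_le_pow₀ (by linarith))
  nlinarith

end Analysis

/-- **Theorem 2 (Randomized oblivious online buy-at-bulk).**
There is a universal constant `C` such that for every metric space `X` and root
`r` there are a probability space and a family of online routing algorithms
`A ω` such that, for every sequence of `k ≥ 1` terminals and every nondecreasing
concave `f : [0,∞) → [0,∞)` with `f 0 = 0`, the random cost is integrable and its
expectation is at most `C·(1 + log₂ k)²·OPT_f`. -/
theorem randomized_oblivious_buy_at_bulk :
    ∃ C : ℝ, 0 < C ∧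
      ∀ (X : Type) [MetricSpace X] (r : X),
        ∃ (P : ProbSpace) (A : P.Ω → List X → List X),
          -- each `A ω` is an online routing algorithm: on a prefix ending at `x`
          -- it produces a path from `x` to `r`
          (∀ (ω : P.Ω) (l : List X) (x : X), IsPath x r (A ω (l ++ [x]))) ∧
          ∀ (k : ℕ), 1 ≤ k → ∀ v : Fin k → X,
            ∀ f : ℝ → ℝ,
              MonotoneOn f (Set.Ici 0) → ConcaveOn ℝ (Set.Ici 0) f → f 0 = 0 →
              MeasureTheory.Integrable
                  (fun ω => costf f (fun s : Fin k => A ω ((List.ofFn v).take (↑s + 1)))) P.μ ∧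
              (∫ ω, costf f (fun s : Fin k => A ω ((List.ofFn v).take (↑s + 1))) ∂P.μ)
                ≤ C * (1 + Real.logb 2 (k : ℝ)) ^ 2 * OPTf f v r := by
  refine ⟨448, by norm_num, fun X _ r =>
    ⟨⟨ℕ → unitInterval, inferInstance, uniformSeq, inferInstance⟩, route r, isPath_route r, ?_⟩⟩
  intro k hk v f hmono hconc hzero
  have hf := isCostFun_of_concaveOn hmono hconc hzero
  have hkey : ∀ Q : Fin k → List X, (∀ s, IsPath (v s) r (Q s)) → _ := fun Q hQ =>
    integral_costf_scalePath_le hf hk (c := centers r (List.ofFn v)) rfl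
      (centers_ofFn_succ r v) hQ
  have hlog : 0 ≤ Real.logb 2 k := Real.logb_nonneg one_lt_two (by exact_mod_cast hk)
  have hdirect : ∀ s, IsPath (v s) r [v s, r] := fun s => ⟨rfl, rfl⟩
  simp only [route_take]
  refine ⟨(hkey _ hdirect).1, ?_⟩
  have hpos : (0 : ℝ) < 448 * (1 + Real.logb 2 k) ^ 2 := by positivity
  rw [← div_le_iff₀' hpos]
  refine le_csInf ⟨_, _, hdirect, rfl⟩ ?_
  rintro _ ⟨Q, hQ, rfl⟩
  rw [div_le_iff₀' hpos]
  exact (hkey Q hQ).2
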